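/- arXiv:0909.2184 — 2 statements merged into one kernel-verified Lean document; each statement's English description precedes it below -/
import Mathlib

section
/- Let K be a field of characteristic 0 and S = K[x_0,…,x_n]. For every homogeneous ideal I ⊆ S generated by an s-dimensional subspace I_r ⊆ S_r of forms of degree r, there exist an invertible linear change of coordinates g ∈ GL(n+1, K) (acting on S by x_i ↦ Σ_j g_{ij} x_j) and a strongly stable monomial ideal J generated by s monomials of degree r, such that (I^g)_r is a vector-space complement of ⟨N(J)_r⟩ in S_r, i.e., Δ_J(I^g) ≠ 0. Consequently, the open subsets U_J^g, for J strongly stable generated by s monomials of degree r and g ranging over linear changes of coordinates, cover the whole Grassmannian G(s, S_r). -/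
open MvPolynomial

namespace Galligo

noncomputable def phi {K : Type*} [Field K] {N : ℕ} (g : Matrix (Fin N) (Fin N) K) :
    MvPolynomial (Fin N) K →ₐ[K] MvPolynomial (Fin N) K :=
  MvPolynomial.aeval (fun i : Fin N => ∑ j : Fin N, g i j • (X j : MvPolynomial (Fin N) K))

def wt {N : ℕ} (r : ℕ) (γ : Fin N →₀ ℕ) : ℕ := ∑ k, γ k * (r + 1) ^ (k : ℕ)

lemma wt_add {N : ℕ} (r : ℕ) (a b : Fin N →₀ ℕ) : wt r (a + b) = wt r a + wt r b := by
  simp [wt, add_mul, Finset.sum_add_distrib]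

lemma wt_single {N : ℕ} (r : ℕ) (i : Fin N) (c : ℕ) :
    wt r (Finsupp.single i c) = c * (r + 1) ^ (i : ℕ) := by
  simp only [wt]
  rw [Finset.sum_eq_single i]
  · simp
  · intro b _ hb
    simp [Finsupp.single_apply, hb.symm]
  · simp

lemma le_of_sum {N : ℕ} {r : ℕ} {a : Fin N →₀ ℕ} (ha : a.sum (fun _ e => e) = r) (k : Fin N) :
    a k ≤ r := by
  rw [Finsupp.sum_fintype _ _ (by simp)] at ha
  rw [← ha]
  exact Finset.single_le_sum (f := fun k => a k) (by simp) (Finset.mem_univ k)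

lemma wt_inj {N : ℕ} {r : ℕ} {a b : Fin N →₀ ℕ} (ha : a.sum (fun _ e => e) = r)
    (hb : b.sum (fun _ e => e) = r) (h : wt r a = wt r b) : a = b := by
  have h2 : finFunctionFinEquiv (fun k => (⟨a k, Nat.lt_succ_of_le (le_of_sum ha k)⟩ : Fin (r+1)))
      = finFunctionFinEquiv (fun k => (⟨b k, Nat.lt_succ_of_le (le_of_sum hb k)⟩ : Fin (r+1))) := by
    apply Fin.ext
    rw [finFunctionFinEquiv_apply, finFunctionFinEquiv_apply]
    exact h
  have h3 := finFunctionFinEquiv.injective h2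
  ext k
  have := congrFun h3 k
  simpa using this

lemma wt_le {N : ℕ} {r : ℕ} {a : Fin N →₀ ℕ} (ha : a.sum (fun _ e => e) = r) :
    wt r a ≤ ∑ k : Fin N, r * (r + 1) ^ (k : ℕ) :=
  Finset.sum_le_sum fun k _ => Nat.mul_le_mul_right _ (le_of_sum ha k)

variable {K : Type*} [Field K]

lemma phi_X {N : ℕ} (g : Matrix (Fin N) (Fin N) K) (i : Fin N) :
    phi g (X i) = ∑ j : Fin N, g i j • (X j : MvPolynomial (Fin N) K) := by
  simp [phi]

lemma phi_comp {N : ℕ} (g h : Matrix (Fin N) (Fin N) K) (p : MvPolynomial (Fin N) K) :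
    phi h (phi g p) = phi (g * h) p := by
  have : (phi h).comp (phi g) = phi (g * h) := by
    apply MvPolynomial.algHom_ext
    intro i
    simp only [AlgHom.comp_apply, phi_X, map_sum, map_smul, Matrix.mul_apply, Finset.smul_sum,
      Finset.sum_smul, smul_smul]
    rw [Finset.sum_comm]
  rw [← this]; rfl

lemma phi_one {N : ℕ} (p : MvPolynomial (Fin N) K) : phi (1 : Matrix (Fin N) (Fin N) K) p = p := by
  have : phi (1 : Matrix (Fin N) (Fin N) K) = AlgHom.id K _ := by
    apply MvPolynomial.algHom_ext
    intro i
    simp [phi_X, Matrix.one_apply, ite_smul]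
  rw [this]; rfl

lemma mem_hom {N r : ℕ} {p : MvPolynomial (Fin N) K} : p ∈ homogeneousSubmodule (Fin N) K r ↔
    ∀ γ, coeff γ p ≠ 0 → γ.sum (fun _ e => e) = r := by
  rw [mem_homogeneousSubmodule]
  have : ∀ γ : Fin N →₀ ℕ, Finsupp.weight (1 : Fin N → ℕ) γ = γ.sum (fun _ e => e) := by
    intro γ
    simp [Finsupp.weight_apply]
  simp only [IsHomogeneous, IsWeightedHomogeneous, this]

lemma phi_hom {N r : ℕ} (g : Matrix (Fin N) (Fin N) K) {p : MvPolynomial (Fin N) K}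
    (hp : p ∈ homogeneousSubmodule (Fin N) K r) : phi g p ∈ homogeneousSubmodule (Fin N) K r := by
  rw [mem_homogeneousSubmodule] at *
  have := hp.aeval (fun i : Fin N => ∑ j : Fin N, g i j • (X j : MvPolynomial (Fin N) K)) (n := 1)
    (fun i => IsHomogeneous.sum _ _ _ fun j _ => by
      rw [smul_eq_C_mul]; exact (isHomogeneous_X _ _).C_mul _)
  rwa [one_mul] at this

lemma phi_diag {N : ℕ} (d : Fin N → K) (γ : Fin N →₀ ℕ) (c : K) :
    phi (Matrix.diagonal d) (monomial γ c) = monomial γ (c * ∏ k, d k ^ γ k) := by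
  rw [phi, aeval_monomial]
  simp only [Matrix.diagonal_apply, ite_smul, zero_smul, Finset.sum_ite_eq, Finset.mem_univ, if_true]
  rw [Finsupp.prod_fintype _ _ (by simp)]
  simp only [smul_eq_C_mul, mul_pow, Finset.prod_mul_distrib]
  rw [monomial_eq (s := γ), Finsupp.prod_fintype _ _ (by simp)]
  simp [mul_assoc]

lemma phi_trans {N : ℕ} {i j : Fin N} (hij : i ≠ j) (α : Fin N →₀ ℕ) :
    phi (Matrix.transvection i j (1 : K)) (monomial α 1) = ∑ p ∈ Finset.range (α i + 1),
      monomial (α.erase i + Finsupp.single i p + Finsupp.single j (α i - p)) ((α i).choose p : K) := by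
  have hX : ∀ k, phi (Matrix.transvection i j (1 : K)) (X k)
      = if k = i then X i + X j else (X k : MvPolynomial (Fin N) K) := by
    intro k
    rw [phi_X]
    simp only [Matrix.transvection, Matrix.add_apply, Matrix.one_apply, Matrix.single_apply, add_smul,
      ite_smul, one_smul, zero_smul, Finset.sum_add_distrib, Finset.sum_ite_eq, Finset.mem_univ, if_true]
    by_cases h : k = i
    · subst h; simp
    · simp [h, Ne.symm h]
  have h1 : phi (Matrix.transvection i j (1 : K)) (monomial (α.erase i) 1) = monomial (α.erase i) 1 := by
    rw [monomial_eq]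
    simp only [C_1, one_mul, Finsupp.prod, map_prod, map_pow, hX]
    apply Finset.prod_congr rfl
    intro k hk
    have : k ≠ i := by
      rintro rfl; simp at hk
    simp [this]
  have h2 : (monomial α (1:K)) = monomial (α.erase i) 1 * X i ^ (α i) := by
    rw [X_pow_eq_monomial, monomial_mul, one_mul, Finsupp.erase_add_single]
  rw [h2, map_mul, h1, map_pow, hX, if_pos rfl, add_pow, Finset.mul_sum]
  apply Finset.sum_congr rfl
  intro p _
  rw [X_pow_eq_monomial, X_pow_eq_monomial, monomial_mul, one_mul,
    ← C_eq_coe_nat, mul_comm _ (C _), C_mul_monomial, monomial_mul]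
  simp [add_assoc]

lemma trans_coeff_ne {N r : ℕ} {i j : Fin N} (hij : i < j) {α γ : Fin N →₀ ℕ}
    (h : coeff γ (phi (Matrix.transvection i j (1 : K)) (monomial α 1)) ≠ 0) (hne : γ ≠ α) :
    wt r α + (r + 1) ^ (j : ℕ) ≤ wt r γ + (r + 1) ^ (i : ℕ) := by
  rw [phi_trans hij.ne, coeff_sum] at h
  obtain ⟨p, hp, h⟩ := Finset.exists_ne_zero_of_sum_ne_zero h
  rw [coeff_monomial] at h
  have hγ : α.erase i + Finsupp.single i p + Finsupp.single j (α i - p) = γ := by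
    by_contra hh; exact h (if_neg hh)
  have hp' : p < α i := by
    rcases Nat.lt_succ_iff_lt_or_eq.1 (Finset.mem_range.1 hp) with h | h
    · exact h
    · subst h
      exfalso; apply hne; rw [← hγ, Nat.sub_self, Finsupp.single_zero, add_zero, Finsupp.erase_add_single]
  have h1 : wt r α = wt r (α.erase i) + α i * (r + 1) ^ (i : ℕ) := by
    rw [← wt_single, ← wt_add, Finsupp.erase_add_single]
  rw [← hγ, wt_add, wt_add, wt_single, wt_single, h1]
  obtain ⟨q, hq⟩ : ∃ q, α i = p + (q + 1) := ⟨α i - p - 1, by omega⟩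
  have hle : (r + 1) ^ (i : ℕ) ≤ (r + 1) ^ (j : ℕ) := Nat.pow_le_pow_right (by omega) hij.le
  rw [hq, Nat.add_sub_cancel_left]
  nlinarith [Nat.mul_le_mul_left q hle]

lemma shift_eq {N : ℕ} {i j : Fin N} {α : Fin N →₀ ℕ} (hα : α i ≠ 0) :
    α - Finsupp.single i 1 + Finsupp.single j 1 =
    α.erase i + Finsupp.single i (α i - 1) + Finsupp.single j 1 := by
  congr 1
  ext k
  by_cases h : k = i
  · subst h; simp
  · simp [h, Finsupp.single_apply, Ne.symm h]

lemma trans_coeff_shift {N : ℕ} {i j : Fin N} (hij : i < j) {α : Fin N →₀ ℕ} (hα : α i ≠ 0) :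
    coeff (α - Finsupp.single i 1 + Finsupp.single j 1)
      (phi (Matrix.transvection i j (1 : K)) (monomial α 1)) = (α i : K) := by
  rw [phi_trans hij.ne, coeff_sum, shift_eq hα, Finset.sum_eq_single (α i - 1)]
  · rw [coeff_monomial, if_pos]
    · rw [Nat.choose_symm (by omega)]; simp
    · congr 2; omega
  · intro p _ hp
    rw [coeff_monomial, if_neg]
    intro h
    have := DFunLike.congr_fun h i
    simp [Finsupp.single_apply, hij.ne'] at this
    exact hp this
  · intro h; simp at h

lemma trans_coeff_self {N : ℕ} {i j : Fin N} (hij : i < j) {α : Fin N →₀ ℕ} :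
    coeff α (phi (Matrix.transvection i j (1 : K)) (monomial α 1)) = 1 := by
  rw [phi_trans hij.ne, coeff_sum, Finset.sum_eq_single (α i)]
  · rw [coeff_monomial, if_pos]
    · simp
    · rw [Nat.sub_self, Finsupp.single_zero, add_zero, Finsupp.erase_add_single]
  · intro p _ hp
    rw [coeff_monomial, if_neg]
    intro h
    have := DFunLike.congr_fun h i
    simp [Finsupp.single_apply, hij.ne'] at this
    exact hp this
  · intro h; simp at h

/-- The Pluecker determinant. -/
noncomputable def D {N s : ℕ} (F : Fin s → MvPolynomial (Fin N) K) (b : Fin s → (Fin N →₀ ℕ)) :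
    Matrix (Fin s) (Fin s) K := Matrix.of fun k l => coeff (b l) (F k)

lemma exists_b {N s : ℕ} (f : Fin s → MvPolynomial (Fin N) K) (hf : LinearIndependent K f) :
    ∃ b, (D f b).det ≠ 0 := by
  let v : (Fin N →₀ ℕ) → (Fin s → K) := fun γ k => coeff γ (f k)
  have htop : Submodule.span K (Set.range v) = ⊤ := by
    by_contra hne
    obtain ⟨φ, hφ, hle⟩ := Submodule.exists_le_ker_of_lt_top _ (lt_top_iff_ne_top.2 hne)
    apply hφ
    have h0 : ∑ k, φ (Pi.single k 1) • f k = 0 := by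
      ext γ
      have : φ (v γ) = 0 := hle (Submodule.subset_span ⟨γ, rfl⟩)
      rw [LinearMap.pi_apply_eq_sum_univ] at this
      rw [coeff_sum, coeff_zero, ← this]
      apply Finset.sum_congr rfl
      intro k _
      rw [coeff_smul, smul_eq_mul, smul_eq_mul, mul_comm]
      congr 2
      ext l
      simp [Pi.single_apply, eq_comm]
    have := Fintype.linearIndependent_iff.1 hf _ h0
    apply LinearMap.pi_ext'
    intro k
    ext
    simpa using this k
  obtain ⟨c, hc, -, hli⟩ := Submodule.exists_fun_fin_finrank_span_eq K (Set.range v)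
  have hs : Module.finrank K (Submodule.span K (Set.range v)) = s := by
    rw [htop]; simp
  let c' : Fin s → (Fin s → K) := fun k => c (Fin.cast hs.symm k)
  have hli' : LinearIndependent K c' := hli.comp _ (Fin.cast_injective _)
  have hc' : ∀ k, ∃ γ, v γ = c' k := fun k => hc _
  choose b hb using hc'
  refine ⟨b, ?_⟩
  have : (D f b).transpose = Matrix.of c' := by
    ext k l
    simp only [Matrix.transpose_apply, D, Matrix.of_apply, ← hb]; rfl
  rw [← Matrix.det_transpose, this]
  have h4 := Matrix.linearIndependent_rows_iff_isUnit.1 (show LinearIndependent K (Matrix.of c').row from hli')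
  exact ((Matrix.isUnit_iff_isUnit_det _).1 h4).ne_zero

lemma D_inj {N s : ℕ} {F : Fin s → MvPolynomial (Fin N) K} {b : Fin s → (Fin N →₀ ℕ)}
    (h : (D F b).det ≠ 0) : Function.Injective b := by
  intro k l hkl
  by_contra hne
  exact h (Matrix.det_zero_of_column_eq hne (fun m => by simp [D, hkl]))

lemma D_deg {N s r : ℕ} {F : Fin s → MvPolynomial (Fin N) K} {b : Fin s → (Fin N →₀ ℕ)}
    (hF : ∀ k, F k ∈ homogeneousSubmodule (Fin N) K r)
    (h : (D F b).det ≠ 0) (l : Fin s) : (b l).sum (fun _ e => e) = r := by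
  by_contra hne
  apply h
  apply Matrix.det_eq_zero_of_column_eq_zero l
  intro k
  by_contra h2
  exact hne (mem_hom.1 (hF k) _ h2)

lemma D_mul {N s : ℕ} (F : Fin s → MvPolynomial (Fin N) K) (b : Fin s → (Fin N →₀ ℕ))
    (A : Matrix (Fin s) (Fin s) K) : D (fun k => ∑ l, A k l • F l) b = A * D F b := by
  ext k l
  simp [D, Matrix.mul_apply, coeff_sum]

lemma tri_det {s : ℕ} (M : Matrix (Fin s) (Fin s) K) (w : Fin s → ℕ)
    (h : ∀ k l, M k l ≠ 0 → k = l ∨ w k < w l) (hd : ∀ k, M k k ≠ 0) : M.det ≠ 0 := by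
  classical
  intro h0
  obtain ⟨v, hv, hM⟩ := Matrix.exists_mulVec_eq_zero_iff.2 h0
  obtain ⟨k0, hk0⟩ := Function.ne_iff.1 hv
  obtain ⟨k, hk, hmax⟩ := Finset.exists_max_image (Finset.univ.filter fun k => v k ≠ 0) w
    ⟨k0, by simpa using hk0⟩
  have := congrFun hM k
  rw [Matrix.mulVec, dotProduct, Finset.sum_eq_single k] at this
  · simp at hk
    simp [hd k, hk] at this
  · intro l _ hl
    by_contra hne
    rcases h k l (left_ne_zero_of_mul hne) with h | h
    · exact hl h.symm
    · have := hmax l (by simpa using right_ne_zero_of_mul hne)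
      omega
  · simp

lemma exch {N s : ℕ} {F : Fin s → MvPolynomial (Fin N) K} {b : Fin s → (Fin N →₀ ℕ)}
    (h : D F b = 1) (k : Fin s) {γ : Fin N →₀ ℕ} (hγ : coeff γ (F k) ≠ 0) :
    (D F (Function.update b k γ)).det ≠ 0 := by
  have hb : ∀ m l, coeff (b l) (F m) = (1 : Matrix (Fin s) (Fin s) K) m l := by
    intro m l; rw [← h]; rfl
  apply tri_det _ (fun l => if l = k then 1 else 0)
  · intro m l hml
    by_cases hl : l = k
    · subst hl
      by_cases hm : m = l
      · exact Or.inl hm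
      · right; simp [hm]
    · left
      simp only [D, Matrix.of_apply, Function.update_of_ne hl, hb, Matrix.one_apply] at hml
      by_contra hne; simp [hne] at hml
  · intro l
    by_cases hl : l = k
    · subst hl; simpa [D] using hγ
    · simp [D, Function.update_of_ne hl, hb]

/-- Degeneration along the torus. -/
lemma degen [CharZero K] {N s r : ℕ} {F : Fin s → MvPolynomial (Fin N) K} {b : Fin s → (Fin N →₀ ℕ)}
    (h1 : ∀ k, coeff (b k) (F k) = 1)
    (h : ∀ k γ, coeff γ (F k) ≠ 0 → γ = b k ∨ wt r γ < wt r (b k))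
    (u : Matrix (Fin N) (Fin N) K) (b' : Fin s → (Fin N →₀ ℕ))
    (hu : (D (fun k => phi u (monomial (b k) 1)) b').det ≠ 0) :
    ∃ d : Fin N → K, (∀ k, d k ≠ 0) ∧ (D (fun k => phi u (phi (Matrix.diagonal d) (F k))) b').det ≠ 0 := by
  let P : Matrix (Fin s) (Fin s) (Polynomial K) := Matrix.of fun k l =>
    ∑ γ ∈ (F k).support, Polynomial.C (coeff γ (F k) * coeff (b' l) (phi u (monomial γ 1))) *
      Polynomial.X ^ (wt r (b k) - wt r γ)
  have hdet : ∀ t : K, P.det.eval t = (P.map (Polynomial.eval t)).det := by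
    intro t
    exact RingHom.map_det (Polynomial.evalRingHom t) P
  have hP0 : P.map (Polynomial.eval 0) = D (fun k => phi u (monomial (b k) 1)) b' := by
    ext k l
    simp only [P, D, Matrix.map_apply, Matrix.of_apply, Polynomial.eval_finsetSum]
    rw [Finset.sum_eq_single (b k)]
    · simp [h1]
    · intro γ hγ hne
      rcases h k γ (by simpa using hγ) with h | h
      · exact absurd h hne
      · have : wt r (b k) - wt r γ ≠ 0 := by omega
        simp [this]
    · intro hb
      simp [h1] at hb
  have hPne : P.det ≠ 0 := by
    intro h0
    apply hu
    rw [← hP0, ← hdet, h0]; simp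
  obtain ⟨t, ht⟩ : ∃ t : K, (P.det * Polynomial.X).eval t ≠ 0 := by
    by_contra hcon
    push Not at hcon
    exact mul_ne_zero hPne Polynomial.X_ne_zero (Polynomial.funext fun t => by simpa using hcon t)
  rw [Polynomial.eval_mul, Polynomial.eval_X] at ht
  have ht0 := right_ne_zero_of_mul ht
  have htd := left_ne_zero_of_mul ht
  refine ⟨fun k => (t⁻¹) ^ ((r + 1) ^ (k : ℕ)), fun k => pow_ne_zero _ (inv_ne_zero ht0), ?_⟩
  rw [hdet] at htd
  have hprod : ∀ γ : Fin N →₀ ℕ, ∏ k : Fin N, ((t⁻¹) ^ ((r + 1) ^ (k : ℕ))) ^ γ k = (t⁻¹) ^ wt r γ := by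
    intro γ
    simp only [wt, ← pow_mul, Finset.prod_pow_eq_pow_sum]
    congr 1
    exact Finset.sum_congr rfl fun k _ => mul_comm _ _
  have : P.map (Polynomial.eval t) = Matrix.diagonal (fun k => t ^ wt r (b k)) *
      D (fun k => phi u (phi (Matrix.diagonal (fun k : Fin N => (t⁻¹) ^ ((r + 1) ^ (k : ℕ)))) (F k))) b' := by
    ext k l
    rw [Matrix.diagonal_mul]
    simp only [P, D, Matrix.map_apply, Matrix.of_apply, Polynomial.eval_finsetSum]
    conv_rhs => rw [(F k).as_sum]
    rw [map_sum, map_sum, coeff_sum, Finset.mul_sum]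
    apply Finset.sum_congr rfl
    intro γ hγ
    rw [phi_diag, hprod]
    have hm : monomial γ (coeff γ (F k) * t⁻¹ ^ wt r γ)
      = (coeff γ (F k) * t⁻¹ ^ wt r γ) • (monomial γ (1 : K) : MvPolynomial (Fin N) K) := by
      simp [smul_monomial]
    rw [hm, map_smul, coeff_smul]
    have hle : wt r γ ≤ wt r (b k) := by
      rcases h k γ (by simpa using hγ) with h | h
      · rw [h]
      · exact h.le
    simp only [Polynomial.eval_mul, Polynomial.eval_C, Polynomial.eval_pow, Polynomial.eval_X, smul_eq_mul]
    rw [pow_sub₀ _ ht0 hle, inv_pow]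
    ring
  rw [this, Matrix.det_mul] at htd
  exact right_ne_zero_of_mul htd

lemma mem_span_mono {N : ℕ} (A : Set (Fin N →₀ ℕ)) (p : MvPolynomial (Fin N) K) :
    p ∈ Submodule.span K ((fun γ : Fin N →₀ ℕ => (monomial γ (1 : K) :
            MvPolynomial (Fin N) K)) '' A) ↔ ∀ γ, coeff γ p ≠ 0 → γ ∈ A := by
  constructor
  · intro hp
    induction hp using Submodule.span_induction with
    | mem x hx =>
      obtain ⟨a, ha, rfl⟩ := hx
      intro γ hγ
      simp only [coeff_monomial] at hγ
      by_cases h : a = γ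
      · exact h ▸ ha
      · simp [h] at hγ
    | zero => simp
    | add x y _ _ hx hy =>
      intro γ hγ
      by_cases h : coeff γ x = 0
      · exact hy γ (by simpa [h] using hγ)
      · exact hx γ h
    | smul c x _ hx =>
      intro γ hγ
      exact hx γ (by rw [coeff_smul] at hγ; exact right_ne_zero_of_mul hγ)
  · intro h
    rw [p.as_sum]
    apply Submodule.sum_mem
    intro γ hγ
    have : monomial γ (coeff γ p) = coeff γ p • (monomial γ (1 : K) : MvPolynomial (Fin N) K) := by
      simp [smul_monomial]
    rw [this]
    exact Submodule.smul_mem _ _ (Submodule.subset_span ⟨γ, h γ (by simpa using hγ), rfl⟩)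

lemma hom_fin {N r : ℕ} : Module.Finite K (homogeneousSubmodule (Fin N) K r) := by
  have : homogeneousSubmodule (Fin N) K r = Submodule.span K ((fun γ : Fin N →₀ ℕ => (monomial γ (1 : K) :
            MvPolynomial (Fin N) K)) '' {γ | γ.sum (fun _ e => e) = r}) := by
    ext p
    rw [mem_hom, mem_span_mono]; rfl
  rw [this]
  apply Module.Finite.span_of_finite
  apply Set.Finite.image
  apply Set.Finite.subset (Finset.finsuppAntidiag (Finset.univ : Finset (Fin N)) r).finite_toSet
  intro γ hγ
  simp only [Set.mem_ofPred_eq] at hγ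
  rw [Finsupp.sum_fintype _ _ (by simp)] at hγ
  simp [Finset.mem_finsuppAntidiag, hγ]

theorem main [CharZero K] {N s r : ℕ} (f : Fin s → MvPolynomial (Fin N) K) (hf : LinearIndependent K f)
    (hr : ∀ k, f k ∈ homogeneousSubmodule (Fin N) K r) :
    ∃ g : Matrix.GeneralLinearGroup (Fin N) K, ∃ b : Fin s → (Fin N →₀ ℕ),
      (D (fun k => phi (g : Matrix (Fin N) (Fin N) K) (f k)) b).det ≠ 0 ∧
      ∀ k i j, i < j → b k i ≠ 0 → ∃ l, b l = b k - Finsupp.single i 1 + Finsupp.single j 1 := by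
  let T : Set ℕ := {w | ∃ g : Matrix.GeneralLinearGroup (Fin N) K, ∃ b : Fin s → (Fin N →₀ ℕ),
      (D (fun k => phi (g : Matrix (Fin N) (Fin N) K) (f k)) b).det ≠ 0 ∧ w = ∑ k, wt r (b k)}
  have hne : T.Nonempty := by
    obtain ⟨b, hb⟩ := exists_b f hf
    exact ⟨_, 1, b, by simpa [phi_one] using hb, rfl⟩
  have hbdd : BddAbove T := by
    refine ⟨∑ k : Fin s, ∑ k : Fin N, r * (r + 1) ^ (k : ℕ), ?_⟩
    rintro w ⟨g, b, hb, rfl⟩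
    exact Finset.sum_le_sum fun k _ => wt_le (D_deg (fun k => phi_hom _ (hr k)) hb k)
  obtain ⟨g, b, hb, hw⟩ := Nat.sSup_mem hne hbdd
  have hmax : ∀ (g' : Matrix.GeneralLinearGroup (Fin N) K) (b' : Fin s → (Fin N →₀ ℕ)),
      (D (fun k => phi (g' : Matrix (Fin N) (Fin N) K) (f k)) b').det ≠ 0 →
      ∑ k, wt r (b' k) ≤ ∑ k, wt r (b k) := by
    intro g' b' h
    rw [← hw]
    exact le_csSup hbdd ⟨g', b', h, rfl⟩
  refine ⟨g, b, hb, ?_⟩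
  have hdeg := D_deg (fun k => phi_hom _ (hr k)) hb
  have hinj := D_inj hb
  set M := D (fun k => phi (g : Matrix (Fin N) (Fin N) K) (f k)) b with hM
  let F : Fin s → MvPolynomial (Fin N) K := fun k => ∑ l, M⁻¹ k l • phi (g : Matrix (Fin N) (Fin N) K) (f l)
  have hunit : IsUnit M.det := isUnit_iff_ne_zero.2 hb
  have hF1 : D F b = 1 := by
    rw [D_mul, ← hM, Matrix.nonsing_inv_mul _ hunit]
  have hFhom : ∀ k, F k ∈ homogeneousSubmodule (Fin N) K r := fun k =>
    Submodule.sum_mem _ fun l _ => Submodule.smul_mem _ _ (phi_hom _ (hr l))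
  have hFT : ∀ (u : Matrix.GeneralLinearGroup (Fin N) K) (b' : Fin s → (Fin N →₀ ℕ)),
      (D (fun k => phi (u : Matrix (Fin N) (Fin N) K) (F k)) b').det ≠ 0 →
      ∑ k, wt r (b' k) ≤ ∑ k, wt r (b k) := by
    intro u b' h
    apply hmax (g * u) b'
    have : (fun k => phi (u : Matrix (Fin N) (Fin N) K) (F k)) =
        fun k => ∑ l, M⁻¹ k l • phi ((g * u : Matrix.GeneralLinearGroup (Fin N) K) : Matrix (Fin N) (Fin N) K) (f l) := by
      funext k
      simp only [F, map_sum, map_smul, phi_comp, Units.val_mul]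
    rw [this, D_mul, Matrix.det_mul] at h
    exact right_ne_zero_of_mul h
  have hupd : ∀ k γ, ∑ l, wt r (Function.update b k γ l) ≤ ∑ l, wt r (b l) → wt r γ ≤ wt r (b k) := by
    intro k γ h
    rw [← Finset.add_sum_erase _ _ (Finset.mem_univ k),
      ← Finset.add_sum_erase (a := k) (f := fun l => wt r (b l)) _ (Finset.mem_univ k)] at h
    have h2 : ∑ l ∈ Finset.univ.erase k, wt r (Function.update b k γ l)
        = ∑ l ∈ Finset.univ.erase k, wt r (b l) :=
      Finset.sum_congr rfl fun l hl => by rw [Function.update_of_ne (Finset.ne_of_mem_erase hl)]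
    rw [h2] at h
    simpa using h
  have hlow : ∀ k γ, coeff γ (F k) ≠ 0 → γ = b k ∨ wt r γ < wt r (b k) := by
    intro k γ hγ
    have h1 := exch hF1 k hγ
    have h2 := hupd k γ (hFT 1 _ (by simpa [phi_one] using h1))
    rcases h2.lt_or_eq with h | h
    · exact Or.inr h
    · exact Or.inl (wt_inj (mem_hom.1 (hFhom k) _ hγ) (hdeg k) h)
  have hone : ∀ k, coeff (b k) (F k) = 1 := by
    intro k
    have := congrFun (congrFun hF1 k) k
    simpa [D] using this
  intro k i j hij hki
  by_contra hcon
  push Not at hcon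
  set β := b k - Finsupp.single i 1 + Finsupp.single j 1 with hβ
  have hwβ : wt r β + (r + 1) ^ (i : ℕ) = wt r (b k) + (r + 1) ^ (j : ℕ) := by
    have h1 : wt r (b k) = wt r ((b k).erase i) + b k i * (r + 1) ^ (i : ℕ) := by
      rw [← wt_single, ← wt_add, Finsupp.erase_add_single]
    rw [hβ, shift_eq hki, wt_add, wt_add, wt_single, wt_single, h1]
    obtain ⟨q, hq⟩ : ∃ q, b k i = q + 1 := ⟨b k i - 1, by omega⟩
    rw [hq, Nat.add_sub_cancel]
    ring
  have hr0 : 0 < r := by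
    have := le_of_sum (hdeg k) i
    omega
  have hlt : (r + 1) ^ (i : ℕ) < (r + 1) ^ (j : ℕ) := Nat.pow_lt_pow_right (by omega) hij
  have hor : ∀ m l, wt r (b m) ≤ wt r (b l) → m = l ∨ wt r (b m) < wt r (b l) := by
    intro m l h
    rcases h.lt_or_eq with h | h
    · exact Or.inr h
    · exact Or.inl (hinj (wt_inj (hdeg m) (hdeg l) h))
  have hdet : (D (fun m => phi (Matrix.transvection i j (1 : K)) (monomial (b m) 1))
      (Function.update b k β)).det ≠ 0 := by
    apply tri_det _ (fun l => wt r (b l))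
    · intro m l hml
      apply hor
      by_cases hl : l = k
      · subst hl
        simp only [D, Matrix.of_apply, Function.update_self] at hml
        have := trans_coeff_ne (r := r) hij hml (fun h => hcon m h.symm)
        omega
      · simp only [D, Matrix.of_apply, Function.update_of_ne hl] at hml
        by_cases hbe : b l = b m
        · rw [hbe]
        · have := trans_coeff_ne (r := r) hij hml hbe
          omega
    · intro l
      by_cases hl : l = k
      · subst hl
        simp only [D, Matrix.of_apply, Function.update_self]
        rw [hβ, trans_coeff_shift hij hki]
        exact_mod_cast hki
      · simp only [D, Matrix.of_apply, Function.update_of_ne hl]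
        rw [trans_coeff_self hij]; exact one_ne_zero
  obtain ⟨d, hd, hdd⟩ := degen hone hlow _ _ hdet
  let u := Matrix.GeneralLinearGroup.mkOfDetNeZero
    (Matrix.diagonal d * Matrix.transvection i j (1 : K)) (by
      rw [Matrix.det_mul, Matrix.det_diagonal, Matrix.det_transvection_of_ne _ _ hij.ne, mul_one]
      exact Finset.prod_ne_zero_iff.2 fun k _ => hd k)
  have := hupd k β (hFT u _ (by
    have h2 : (u : Matrix (Fin N) (Fin N) K) = Matrix.diagonal d * Matrix.transvection i j (1 : K) := rfl
    rw [h2]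
    simpa only [phi_comp] using hdd))
  omega

end Galligo

/-- **Lemma 2.1** (via Galligo's theorem): over a field of characteristic `0`, for every
homogeneous ideal `I` generated by an `s`-dimensional subspace `V = I_r ⊆ S_r` there exist
a linear change of coordinates `g ∈ GL(n+1, K)` (acting by `x_i ↦ Σ_j g_{ij} x_j`) and a
strongly stable monomial ideal `J` generated by `s` monomials of degree `r` such that
`(I^g)_r` (the image of `V` under `g`) is a vector-space complement of `⟨N(J)_r⟩` in `S_r`,
i.e. `Δ_J(I^g) ≠ 0`.  Hence the open sets `U_J^g`, `J` Borel, cover the Grassmannian. -/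
theorem stmt_8 {K : Type*} [Field K] [CharZero K] {n : ℕ} (r s : ℕ)
    (V : Submodule K (MvPolynomial (Fin (n + 1)) K))
    (hV : V ≤ homogeneousSubmodule (Fin (n + 1)) K r)
    (hVdim : Module.finrank K V = s) :
    ∃ g : Matrix.GeneralLinearGroup (Fin (n + 1)) K,
    ∃ B : Finset (Fin (n + 1) →₀ ℕ),
      B.card = s ∧
      (∀ α ∈ B, α.sum (fun _ e => e) = r) ∧
      (∀ β : Fin (n + 1) →₀ ℕ,
        monomial β (1 : K) ∈ Ideal.span ((fun a : Fin (n + 1) →₀ ℕ => (monomial a (1 : K) :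
            MvPolynomial (Fin (n + 1)) K)) '' ↑B) →
        ∀ i j : Fin (n + 1), i < j → β i ≠ 0 →
          monomial (β - Finsupp.single i 1 + Finsupp.single j 1) (1 : K) ∈
            Ideal.span ((fun a : Fin (n + 1) →₀ ℕ => (monomial a (1 : K) :
              MvPolynomial (Fin (n + 1)) K)) '' ↑B)) ∧
      (Disjoint
          (Submodule.map (MvPolynomial.aeval (fun i : Fin (n + 1) =>
            ∑ j : Fin (n + 1), (g : Matrix (Fin (n + 1)) (Fin (n + 1)) K) i j •
              (X j : MvPolynomial (Fin (n + 1)) K)) : MvPolynomial (Fin (n + 1)) K →ₐ[K]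
                MvPolynomial (Fin (n + 1)) K).toLinearMap V)
          (Submodule.span K ((fun γ : Fin (n + 1) →₀ ℕ => (monomial γ (1 : K) :
            MvPolynomial (Fin (n + 1)) K)) '' {γ | γ.sum (fun _ e => e) = r ∧ γ ∉ B}))
        ∧ (Submodule.map (MvPolynomial.aeval (fun i : Fin (n + 1) =>
            ∑ j : Fin (n + 1), (g : Matrix (Fin (n + 1)) (Fin (n + 1)) K) i j •
              (X j : MvPolynomial (Fin (n + 1)) K)) : MvPolynomial (Fin (n + 1)) K →ₐ[K]
                MvPolynomial (Fin (n + 1)) K).toLinearMap V)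
          ⊔ Submodule.span K ((fun γ : Fin (n + 1) →₀ ℕ => (monomial γ (1 : K) :
            MvPolynomial (Fin (n + 1)) K)) '' {γ | γ.sum (fun _ e => e) = r ∧ γ ∉ B})
          = homogeneousSubmodule (Fin (n + 1)) K r) := by
  classical
  have hfin : Module.Finite K (homogeneousSubmodule (Fin (n + 1)) K r) := Galligo.hom_fin
  have hVfin : Module.Finite K V := Module.Finite.of_injective (Submodule.inclusion hV)
    (Submodule.inclusion_injective hV)
  let e := Module.finBasisOfFinrankEq K V hVdim
  let f : Fin s → MvPolynomial (Fin (n + 1)) K := fun k => (e k : MvPolynomial (Fin (n + 1)) K)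
  have hf : LinearIndependent K f := e.linearIndependent.map' V.subtype (Submodule.ker_subtype V)
  have hr : ∀ k, f k ∈ homogeneousSubmodule (Fin (n + 1)) K r := fun k => hV (e k).2
  obtain ⟨g, b, hdet, hss⟩ := Galligo.main f hf hr
  have hinj := Galligo.D_inj hdet
  have hdeg := Galligo.D_deg (fun k => Galligo.phi_hom _ (hr k)) hdet
  have hmem : ∀ v ∈ V, ∃ c : Fin s → K, v = ∑ k, c k • f k := by
    intro v hv
    refine ⟨fun k => e.repr ⟨v, hv⟩ k, ?_⟩
    have := congrArg (Submodule.subtype V) (e.sum_repr ⟨v, hv⟩)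
    rw [map_sum] at this
    exact this.symm
  have hcoef : ∀ (c : Fin s → K) l, coeff (b l) (Galligo.phi (g : Matrix _ _ K) (∑ k, c k • f k))
      = Matrix.vecMul c (Galligo.D (fun k => Galligo.phi (g : Matrix _ _ K) (f k)) b) l := by
    intro c l
    simp [Galligo.D, Matrix.vecMul, dotProduct, coeff_sum]
  refine ⟨g, Finset.univ.image b, ?_, ?_, ?_, ?_, ?_⟩
  · rw [Finset.card_image_of_injective _ hinj]; simp
  · intro α hα
    obtain ⟨k, -, rfl⟩ := Finset.mem_image.1 hα
    exact hdeg k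
  · intro β hβ i j hij hi
    rw [mem_ideal_span_monomial_image] at hβ ⊢
    obtain ⟨a, ha, hle⟩ := hβ β (by simp [support_monomial])
    intro xi hxi
    have hxi : xi = β - Finsupp.single i 1 + Finsupp.single j 1 := by
      simpa [support_monomial] using hxi
    subst hxi
    by_cases hai : a i < β i
    · refine ⟨a, ha, ?_⟩
      intro k
      have := hle k
      by_cases hk : i = k
      · subst hk
        simp; omega
      · simp [Finsupp.single_apply, hk]; omega
    · obtain ⟨k, -, rfl⟩ := Finset.mem_image.1 (Finset.mem_coe.1 ha)
      obtain ⟨l, hl⟩ := hss k i j hij (by omega)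
      refine ⟨b l, by simp, ?_⟩
      rw [hl]
      intro m
      have := hle m
      simp only [Finsupp.add_apply, Finsupp.tsub_apply]
      omega
  · rw [Submodule.disjoint_def]
    intro x hx hx2
    rw [Galligo.mem_span_mono] at hx2
    obtain ⟨v, hv, rfl⟩ := hx
    obtain ⟨c, rfl⟩ := hmem v hv
    have h0 : Matrix.vecMul c (Galligo.D (fun k => Galligo.phi (g : Matrix _ _ K) (f k)) b) = 0 := by
      funext l
      rw [← hcoef]
      by_contra hne
      exact (hx2 (b l) hne).2 (by simp)
    have hc : c = 0 := by
      by_contra hc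
      exact hdet (Matrix.exists_vecMul_eq_zero_iff.1 ⟨c, hc, h0⟩)
    simp [hc]
  · apply le_antisymm
    · apply sup_le
      · rintro _ ⟨v, hv, rfl⟩
        exact Galligo.phi_hom _ (hV hv)
      · intro x hx
        rw [Galligo.mem_span_mono] at hx
        exact Galligo.mem_hom.2 fun γ hγ => (hx γ hγ).1
    · intro p hp
      set M := Galligo.D (fun k => Galligo.phi (g : Matrix _ _ K) (f k)) b with hM
      let c : Fin s → K := Matrix.vecMul (fun l => coeff (b l) p) M⁻¹
      have hq : (∑ k, c k • f k) ∈ V :=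
        Submodule.sum_mem _ fun k _ => Submodule.smul_mem _ _ (e k).2
      rw [Submodule.mem_sup]
      refine ⟨_, Submodule.mem_map_of_mem hq, p - Galligo.phi (g : Matrix _ _ K) (∑ k, c k • f k),
        ?_, add_sub_cancel _ _⟩
      rw [Galligo.mem_span_mono]
      intro γ hγ
      refine ⟨Galligo.mem_hom.1 (Submodule.sub_mem _ hp (Galligo.phi_hom _ (hV hq))) γ hγ, ?_⟩
      intro hγB
      obtain ⟨l, -, rfl⟩ := Finset.mem_image.1 hγB
      apply hγ
      rw [coeff_sub, hcoef, Matrix.vecMul_vecMul,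
        Matrix.nonsing_inv_mul _ (isUnit_iff_ne_zero.2 hdet), Matrix.vecMul_one, sub_self]
end

section
/- Let J ⊆ S = K[x_0,…,x_n] be a strongly stable monomial ideal, let G be a J-marked set, and let I = (G) be the ideal generated by G. Then the residue classes of the monomials of N(J) span the quotient S/I as a K-vector space; consequently, for every degree m, dim_K (S/I)_m ≤ dim_K (S/J)_m, or equivalently dim_K I_m ≥ dim_K J_m. -/
open MvPolynomial

theorem star_exists {N : ℕ} (A : Set (Fin N →₀ ℕ)) (hup : ∀ a b, a ∈ A → a ≤ b → b ∈ A)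
    (hSS : ∀ β ∈ A, ∀ i j : Fin N, i < j → β i ≠ 0 →
      β - Finsupp.single i 1 + Finsupp.single j 1 ∈ A)
    (d : ℕ) : ∀ β ∈ A, β.degree = d → ∃ α η : Fin N →₀ ℕ, β = α + η ∧
      (α ∈ A ∧ ∀ γ : Fin N →₀ ℕ, γ ≤ α → γ ≠ α → γ ∉ A) ∧
      ∀ i j, η i ≠ 0 → α j ≠ 0 → i ≤ j := by
  induction d with
  | zero =>
    intro β hβ hd
    have h0 : β = 0 := (Finsupp.degree_eq_zero_iff β).mp hd
    subst h0
    refine ⟨0, 0, by simp, ⟨hβ, ?_⟩, by simp⟩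
    intro γ h1 h2
    exact absurd (le_antisymm h1 (fun _ => Nat.zero_le _)) h2
  | succ d ih =>
    intro β hβ hd
    by_cases hmin : ∀ γ : Fin N →₀ ℕ, γ ≤ β → γ ≠ β → γ ∉ A
    · exact ⟨β, 0, by simp, ⟨hβ, hmin⟩, by simp⟩
    push Not at hmin
    obtain ⟨γ, hle, hne, hγ⟩ := hmin
    have hj : ∃ j, γ j < β j := by
      by_contra hcon
      push Not at hcon
      exact hne (le_antisymm hle hcon)
    obtain ⟨j, hj⟩ := hj
    have hjA : β - Finsupp.single j 1 ∈ A := by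
      refine hup γ _ hγ ?_
      intro k
      have := hle k
      simp only [Finsupp.tsub_apply, Finsupp.single_apply]
      split_ifs with h
      · subst h; omega
      · simpa using this
    have hsup : β.support.Nonempty := ⟨j, by simp; omega⟩
    obtain ⟨i, hi, himin⟩ : ∃ i, β i ≠ 0 ∧ ∀ k, β k ≠ 0 → i ≤ k :=
      ⟨β.support.min' hsup, by simpa using β.support.min'_mem hsup,
        fun k hk => β.support.min'_le k (by simpa using hk)⟩
    have hiA : β - Finsupp.single i 1 ∈ A := by
      rcases (himin j (by omega)).eq_or_lt with h | h
      · rwa [h]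
      · have := hSS _ hjA i j h (by
          simp only [Finsupp.tsub_apply, Finsupp.single_apply, if_neg h.ne']; simpa using hi)
        convert this using 1
        ext k
        simp only [Finsupp.tsub_apply, Finsupp.add_apply, Finsupp.single_apply]
        split_ifs with h1 h2 h2
        · subst h1; subst h2; omega
        · omega
        · subst h2; omega
        · omega
    have hadd : β - Finsupp.single i 1 + Finsupp.single i 1 = β := by
      ext k
      simp only [Finsupp.tsub_apply, Finsupp.add_apply, Finsupp.single_apply]
      split_ifs with h1
      · subst h1; omega
      · omega
    obtain ⟨α, η, h1, h2, h3⟩ := ih _ hiA (by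
      have := congrArg Finsupp.degree hadd
      rw [map_add, Finsupp.degree_single] at this
      omega)
    refine ⟨α, η + Finsupp.single i 1, by rw [← add_assoc, ← h1, hadd], h2, ?_⟩
    intro k l hk hl
    have hβl : β l ≠ 0 := by
      rw [← hadd, h1]; simp; omega
    by_cases hki : k = i
    · subst hki; exact himin l hβl
    · refine h3 k l ?_ hl
      simpa [Finsupp.single_apply, Ne.symm hki] using hk

theorem star_lex {N : ℕ} (A : Set (Fin N →₀ ℕ)) (hup : ∀ a b, a ∈ A → a ≤ b → b ∈ A)
    (η γ α' η' : Fin N →₀ ℕ) (h : η + γ = α' + η') (hγ : γ ∉ A) (hα : α' ∈ A)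
    (hst : ∀ i j, η' i ≠ 0 → α' j ≠ 0 → i ≤ j) :
    Pi.Lex (· > ·) (fun {_} => (· < ·)) (η' : Fin N → ℕ) η := by
  have hk : ∀ k, η k + γ k = α' k + η' k := fun k => by simpa using DFunLike.congr_fun h k
  have hle : ¬ α' ≤ γ := fun hle => hγ (hup _ _ hα hle)
  by_cases hne : η' = η
  · subst hne
    exact absurd (fun k => by have := hk k; omega) hle
  let D := Finset.univ.filter (fun k => η' k ≠ η k)
  have hD : D.Nonempty := by
    by_contra hD
    apply hne
    ext k
    by_contra hc
    exact hD ⟨k, by simp [D, hc]⟩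
  have hm := D.max'_mem hD
  have hmax : ∀ k, D.max' hD < k → η' k = η k := by
    intro k hlt
    by_contra hc
    exact absurd (D.le_max' k (by simp [D, hc])) (not_le.mpr hlt)
  generalize D.max' hD = m at hm hmax
  have hm' : η' m ≠ η m := by simpa [D] using hm
  refine ⟨m, fun k hlt => hmax k hlt, ?_⟩
  by_contra hc
  apply hle
  intro k
  have := hk k
  rcases lt_trichotomy k m with h1 | h1 | h1
  · have : α' k = 0 := by
      by_contra h0
      exact absurd (hst m k (by omega) h0) (not_le.mpr h1)
    omega
  · subst h1; omega
  · have := hmax k h1; omega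

theorem wf_lex (N : ℕ) : WellFounded (fun a b : Fin N →₀ ℕ =>
    Pi.Lex (· > ·) (fun {_} => (· < ·)) (a : Fin N → ℕ) b) :=
  InvImage.wf (fun a : Fin N →₀ ℕ => (a : Fin N → ℕ))
    (Pi.Lex.wellFounded (· > ·) (fun _ => wellFounded_lt))

/-- **[CR, Cor. 2.3]**: if `J` is a strongly stable monomial ideal, `G` a `J`-marked set
(polynomials `x^α − T α` with `x^α` in the minimal basis `B_J`, `T α` homogeneous of the same
degree supported on `N(J)`), and `I = (G)`, then the classes of the monomials of `N(J)` span
`S/I` as a `K`-vector space; consequently `dim_K I_m ≥ dim_K J_m` for every degree `m`. -/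
theorem stmt_9 {K : Type*} [Field K] {n : ℕ}
    (J : Ideal (MvPolynomial (Fin (n + 1)) K))
    (hmon : ∃ B : Set (Fin (n + 1) →₀ ℕ),
      J = Ideal.span ((fun a : Fin (n + 1) →₀ ℕ => (monomial a (1 : K) :
        MvPolynomial (Fin (n + 1)) K)) '' B))
    (hSS : ∀ β : Fin (n + 1) →₀ ℕ, monomial β (1 : K) ∈ J →
      ∀ i j : Fin (n + 1), i < j → β i ≠ 0 →
        monomial (β - Finsupp.single i 1 + Finsupp.single j 1) (1 : K) ∈ J)
    (BJ : Set (Fin (n + 1) →₀ ℕ))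
    (hBJ : BJ = {α : Fin (n + 1) →₀ ℕ | monomial α (1 : K) ∈ J ∧
      ∀ γ : Fin (n + 1) →₀ ℕ, γ ≤ α → γ ≠ α → monomial γ (1 : K) ∉ J})
    (T : (Fin (n + 1) →₀ ℕ) → MvPolynomial (Fin (n + 1)) K)
    (hT : ∀ α ∈ BJ, T α ∈ homogeneousSubmodule (Fin (n + 1)) K (α.sum fun _ e => e) ∧
      ∀ γ ∈ (T α).support, monomial γ (1 : K) ∉ J)
    (I : Ideal (MvPolynomial (Fin (n + 1)) K))
    (hI : I = Ideal.span ((fun α : Fin (n + 1) →₀ ℕ =>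
      (monomial α (1 : K) : MvPolynomial (Fin (n + 1)) K) - T α) '' BJ)) :
    Submodule.span K (Set.range
        (fun γ : {γ : Fin (n + 1) →₀ ℕ // monomial γ (1 : K) ∉ J} =>
          Ideal.Quotient.mk I (monomial (γ : Fin (n + 1) →₀ ℕ) (1 : K)))) = ⊤
    ∧ ∀ m : ℕ,
        Module.finrank K
          ↥(Submodule.restrictScalars K J ⊓ homogeneousSubmodule (Fin (n + 1)) K m)
        ≤ Module.finrank K
          ↥(Submodule.restrictScalars K I ⊓ homogeneousSubmodule (Fin (n + 1)) K m) := by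
  set A : Set (Fin (n + 1) →₀ ℕ) := {a | monomial a (1 : K) ∈ J} with hA
  have hup : ∀ a b, a ∈ A → a ≤ b → b ∈ A := by
    intro a b ha hab
    have h : (monomial b (1 : K)) = monomial (b - a) 1 * monomial a 1 := by
      rw [monomial_mul, tsub_add_cancel_of_le hab, one_mul]
    change monomial b (1 : K) ∈ J
    rw [h]
    exact J.mul_mem_left _ ha
  have hJsupp : ∀ p ∈ J, ∀ γ ∈ p.support, γ ∈ A := by
    obtain ⟨B, hB⟩ := hmon
    intro p hp γ hγ
    rw [hB, mem_ideal_span_monomial_image] at hp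
    obtain ⟨b, hb, hbγ⟩ := hp γ hγ
    refine hup b γ ?_ hbγ
    change monomial b (1 : K) ∈ J
    rw [hB]
    exact Ideal.subset_span ⟨b, hb, rfl⟩
  let W : ℕ → Submodule K (MvPolynomial (Fin (n + 1)) K) := fun m =>
    restrictSupport K {γ | γ ∉ A ∧ γ.degree = m}
  let Im : ℕ → Submodule K (MvPolynomial (Fin (n + 1)) K) := fun m =>
    Submodule.restrictScalars K I ⊓ homogeneousSubmodule (Fin (n + 1)) K m
  have hWH : ∀ m, W m ≤ homogeneousSubmodule (Fin (n + 1)) K m := by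
    intro m
    simp only [W]
    rw [restrictSupport_eq_span, Submodule.span_le]
    rintro _ ⟨γ, hγ, rfl⟩
    exact isHomogeneous_monomial _ hγ.2
  have hN : ∀ β, β ∉ A → monomial β (1 : K) ∈ W β.degree := by
    intro β hβ
    simp only [W]
    rw [monomial_mem_restrictSupport]
    exact Or.inl ⟨hβ, rfl⟩
  have key : ∀ η α : Fin (n + 1) →₀ ℕ, α ∈ BJ → (∀ i j, η i ≠ 0 → α j ≠ 0 → i ≤ j) →
      monomial (α + η) (1 : K) ∈ Im (α + η).degree ⊔ W (α + η).degree := by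
    intro η
    induction η using (wf_lex (n + 1)).induction with
    | _ η ih =>
    intro α hα hst
    obtain ⟨hTh, hTs⟩ := hT α hα
    have hdeg : (α.sum fun _ e => e) = α.degree := rfl
    rw [hdeg, mem_homogeneousSubmodule] at hTh
    have hsplit : monomial (α + η) (1 : K) =
        monomial η 1 * (monomial α 1 - T α) + monomial η 1 * T α := by
      rw [← mul_add, sub_add_cancel, monomial_mul, add_comm α η, one_mul]
    have hdd : (α + η).degree = η.degree + α.degree := by rw [map_add, add_comm]
    rw [hsplit]
    refine add_mem (Submodule.mem_sup_left ⟨?_, ?_⟩) ?_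
    · change _ ∈ I
      rw [hI]
      exact Ideal.mul_mem_left _ _ (Ideal.subset_span ⟨α, hα, rfl⟩)
    · rw [hdd]
      change IsHomogeneous _ _
      exact (isHomogeneous_monomial _ rfl).mul ((isHomogeneous_monomial _ rfl).sub hTh)
    · rw [(T α).as_sum, Finset.mul_sum]
      refine Submodule.sum_mem _ fun γ hγ => ?_
      have hγA : γ ∉ A := hTs γ hγ
      have hγd : γ.degree = α.degree := by
        by_contra hc
        exact (mem_support_iff.mp hγ) (hTh.coeff_eq_zero hc)
      have h1 : monomial η (1 : K) * monomial γ (coeff γ (T α)) =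
          coeff γ (T α) • monomial (η + γ) (1 : K) := by
        rw [monomial_mul, smul_monomial]; simp
      rw [h1]
      refine Submodule.smul_mem _ _ ?_
      have h2 : (α + η).degree = (η + γ).degree := by rw [hdd, map_add, hγd]
      rw [h2]
      by_cases hin : η + γ ∈ A
      · obtain ⟨α', η', e, hm, hst'⟩ := star_exists A hup hSS _ _ hin rfl
        have hlex := star_lex A hup η γ α' η' e hγA hm.1 hst'
        rw [e]
        exact ih η' hlex α' (by rw [hBJ]; exact hm) hst'
      · exact Submodule.mem_sup_right (hN _ hin)
  have all : ∀ β : Fin (n + 1) →₀ ℕ, monomial β (1 : K) ∈ Im β.degree ⊔ W β.degree := by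
    intro β
    by_cases hin : β ∈ A
    · obtain ⟨α', η', e, hm, hst'⟩ := star_exists A hup hSS _ _ hin rfl
      rw [e]
      exact key η' α' (by rw [hBJ]; exact hm) hst'
    · exact Submodule.mem_sup_right (hN _ hin)
  constructor
  · rw [eq_top_iff]
    rintro q -
    obtain ⟨p, rfl⟩ := Ideal.Quotient.mk_surjective q
    rw [p.as_sum, map_sum]
    refine Submodule.sum_mem _ fun β _ => ?_
    have h1 : monomial β (coeff β p) = coeff β p • monomial β (1 : K) := by
      rw [smul_monomial]; simp
    rw [h1]
    change Ideal.Quotient.mkₐ K I _ ∈ _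
    rw [map_smul]
    refine Submodule.smul_mem _ _ ?_
    obtain ⟨a, ha, b, hb, hab⟩ := Submodule.mem_sup.mp (all β)
    rw [← hab, map_add]
    have ha0 : Ideal.Quotient.mkₐ K I a = 0 := Ideal.Quotient.eq_zero_iff_mem.mpr ha.1
    rw [ha0, zero_add]
    simp only [W] at hb
    rw [restrictSupport_eq_span] at hb
    have := Submodule.mem_map_of_mem (f := (Ideal.Quotient.mkₐ K I).toLinearMap) hb
    rw [Submodule.map_span] at this
    refine Submodule.span_mono ?_ this
    rintro _ ⟨_, ⟨γ, hγ, rfl⟩, rfl⟩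
    exact ⟨⟨γ, hγ.1⟩, rfl⟩
  · intro m
    have hfin : FiniteDimensional K (homogeneousSubmodule (Fin (n + 1)) K m) :=
      Module.Finite.iff_fg.mpr (homogeneousSubmodule_fg _ _ m)
    have hJH : Submodule.restrictScalars K J ⊓ homogeneousSubmodule (Fin (n + 1)) K m ≤
      homogeneousSubmodule (Fin (n + 1)) K m := inf_le_right
    have hIH : Im m ≤ homogeneousSubmodule (Fin (n + 1)) K m := inf_le_right
    have f1 := Submodule.finiteDimensional_of_le hJH
    have f2 := Submodule.finiteDimensional_of_le hIH
    have f3 := Submodule.finiteDimensional_of_le (hWH m)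
    have hle : homogeneousSubmodule (Fin (n + 1)) K m ≤ Im m ⊔ W m := by
      intro p hp
      rw [p.as_sum]
      refine Submodule.sum_mem _ fun β hβ => ?_
      have hd : β.degree = m := by
        by_contra hc
        exact (mem_support_iff.mp hβ)
          (((mem_homogeneousSubmodule _ _).mp hp).coeff_eq_zero hc)
      have h1 : monomial β (coeff β p) = coeff β p • monomial β (1 : K) := by
        rw [smul_monomial]; simp
      rw [h1, ← hd]
      exact Submodule.smul_mem _ _ (all β)
    have hdis : (Submodule.restrictScalars K J ⊓ homogeneousSubmodule (Fin (n + 1)) K m) ⊓ W m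
        = ⊥ := by
      rw [eq_bot_iff]
      rintro p ⟨⟨hp, -⟩, hw⟩
      rw [Submodule.mem_bot, ← support_eq_empty, Finset.eq_empty_iff_forall_notMem]
      intro γ hγ
      exact (((mem_restrictSupport_iff (R := K)).mp hw) hγ).1 (hJsupp p hp γ hγ)
    have e1 := Submodule.finrank_sup_add_finrank_inf_eq
      (Submodule.restrictScalars K J ⊓ homogeneousSubmodule (Fin (n + 1)) K m) (W m)
    rw [hdis, finrank_bot, add_zero] at e1
    have e2 := Submodule.finrank_mono (sup_le hJH (hWH m))
    have e3 := Submodule.finrank_mono hle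
    have e4 := Submodule.finrank_add_le_finrank_add_finrank (Im m) (W m)
    change _ ≤ Module.finrank K (Im m)
    omega
end
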